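/- Strong Maximum Principle: assume F satisfies (F1) and (F2A) with constants 0 < λ ≤ Λ and φ satisfying the Osgood condition (φ_A). Let Ω ⊆ ℝⁿ be an open connected set and let u be an upper semicontinuous viscosity subsolution of F(x,u,Du,D²u) = 0 in Ω. If there exists x₀ ∈ Ω with u(x₀) > 0 and u(x₀) ≥ u(x) for all x ∈ Ω (u attains a positive maximum in Ω), then u is constant on Ω. -/

import Mathlib

open Metric Set Filter MeasureTheory
open scoped Topology RealInnerProductSpace Classical

noncomputable section

/-- Euclidean space `ℝⁿ`. -/
abbrev Eucl (n : ℕ) := EuclideanSpace ℝ (Fin n)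

/-- Real `n × n` matrices. -/
abbrev Mat (n : ℕ) := Matrix (Fin n) (Fin n) ℝ

variable {n : ℕ}

/-- Eigenvalues of a matrix (junk value `0` if the matrix is not symmetric). -/
noncomputable def eigenvals (X : Mat n) : Fin n → ℝ :=
  if h : X.IsHermitian then h.eigenvalues else 0

/-- The Pucci maximal operator `P⁺_{λ,Λ}(X) = -λ Σ_{eᵢ ≥ 0} eᵢ - Λ Σ_{eᵢ < 0} eᵢ`. -/
noncomputable def pucciPlus (lam Lam : ℝ) (X : Mat n) : ℝ :=
  ∑ i, (if 0 ≤ eigenvals X i then -(lam * eigenvals X i) else -(Lam * eigenvals X i))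

/-- The Pucci minimal operator `P⁻_{λ,Λ}(X) = -Λ Σ_{eᵢ ≥ 0} eᵢ - λ Σ_{eᵢ < 0} eᵢ`. -/
noncomputable def pucciMinus (lam Lam : ℝ) (X : Mat n) : ℝ :=
  ∑ i, (if 0 ≤ eigenvals X i then -(Lam * eigenvals X i) else -(lam * eigenvals X i))

/-- The positive semidefinite order `X ≤ Y` on symmetric matrices. -/
def matLE (X Y : Mat n) : Prop := (Y - X).PosSemidef

/-- Structure condition (F1): `F(x,u,p,X) ≥ F(x,v,p,Y)` whenever `u ≥ v` and `X ≤ Y`. -/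
def CondF1 (F : Eucl n → ℝ → Eucl n → Mat n → ℝ) : Prop :=
  ∀ x u v p X Y, v ≤ u → matLE X Y → F x v p Y ≤ F x u p X

/-- Structure condition (F2A): `-F(x,0,p,X) ≤ φ(|p|) - P⁻_{λ,Λ}(X)`. -/
def CondF2A (lam Lam : ℝ) (φ : ℝ → ℝ) (F : Eucl n → ℝ → Eucl n → Mat n → ℝ) : Prop :=
  ∀ x p X, X.IsHermitian → -F x 0 p X ≤ φ ‖p‖ - pucciMinus lam Lam X

/-- Structure condition (F2B): `F(x,0,p,X) ≤ φ(|p|) + P⁺_{λ,Λ}(X)`. -/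
def CondF2B (lam Lam : ℝ) (φ : ℝ → ℝ) (F : Eucl n → ℝ → Eucl n → Mat n → ℝ) : Prop :=
  ∀ x p X, X.IsHermitian → F x 0 p X ≤ φ ‖p‖ + pucciPlus lam Lam X

/-- Structure condition (F2B*): `F(x,r,p,X) ≤ φ(|p|) + P⁺_{λ,Λ}(X) + γ(r)` for `r > 0`. -/
def CondF2Bstar (lam Lam : ℝ) (φ γF : ℝ → ℝ) (F : Eucl n → ℝ → Eucl n → Mat n → ℝ) : Prop :=
  ∀ x (r : ℝ) p X, 0 < r → X.IsHermitian →
    F x r p X ≤ φ ‖p‖ + pucciPlus lam Lam X + γF r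

/-- `γ` is nonnegative and dominated by `φ`: `γ(r) ≤ C* φ(r)` whenever `0 < r ≤ 1`. -/
def GammaDominated (Cstar : ℝ) (φ γF : ℝ → ℝ) : Prop :=
  (∀ r : ℝ, 0 < r → 0 ≤ γF r) ∧ ∀ r : ℝ, 0 < r → r ≤ 1 → γF r ≤ Cstar * φ r

/-- Standing assumptions on `φ : [0,∞) → [0,∞)`: continuous, strictly increasing and
`φ(t) ≥ t`. -/
def PhiAdmissible (φ : ℝ → ℝ) : Prop :=
  ContinuousOn φ (Ici 0) ∧ StrictMonoOn φ (Ici 0) ∧ ∀ t : ℝ, 0 ≤ t → t ≤ φ t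

/-- The Osgood condition (φ_A): `∫₀¹ dt / φ(t) = ∞`, as divergence of the improper
Riemann integral. -/
def OsgoodCondition (φ : ℝ → ℝ) : Prop :=
  Tendsto (fun ε : ℝ => ∫ t in ε..1, 1 / φ t) (𝓝[>] 0) atTop

/-- Condition (φ_B): for every sufficiently small `ε > 0`, `∫₀^ε f_ν(t) dt → ∞` as `ν → ∞`,
where `f_ν` solves `f' = -φ(f)`, `f(0) = ν`. -/
def CondPhiB (φ : ℝ → ℝ) : Prop :=
  ∃ ε₀ > (0:ℝ), ∀ ε : ℝ, 0 < ε → ε ≤ ε₀ → ∀ M : ℝ, 0 < M → ∃ ν₀ > (0:ℝ), ∀ ν : ℝ, ν₀ ≤ ν →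
    ∀ f : ℝ → ℝ, (∀ t ∈ Icc (0:ℝ) ε, 0 ≤ f t) → f 0 = ν →
      (∀ t ∈ Icc (0:ℝ) ε, HasDerivAt f (-φ (f t)) t) →
      M ≤ ∫ t in (0:ℝ)..ε, f t

/-- The Hessian matrix of a real valued function on Euclidean space. -/
noncomputable def hess (ψ : Eucl n → ℝ) (x : Eucl n) : Mat n :=
  Matrix.of fun i j =>
    iteratedFDeriv ℝ 2 ψ x ![EuclideanSpace.single i 1, EuclideanSpace.single j 1]

/-- Viscosity subsolution of `F(x,u,Du,D²u) = 0` in the open set `Ω`. -/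
def ViscositySubsolution (F : Eucl n → ℝ → Eucl n → Mat n → ℝ) (Ω : Set (Eucl n))
    (u : Eucl n → ℝ) : Prop :=
  ∀ ψ : Eucl n → ℝ, ContDiffOn ℝ 2 ψ Ω → ∀ x₀ ∈ Ω,
    IsLocalMaxOn (fun x => u x - ψ x) Ω x₀ →
    F x₀ (u x₀) (gradient ψ x₀) (hess ψ x₀) ≤ 0

/-- Viscosity supersolution of `F(x,u,Du,D²u) = 0` in the open set `Ω`. -/
def ViscositySupersolution (F : Eucl n → ℝ → Eucl n → Mat n → ℝ) (Ω : Set (Eucl n))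
    (v : Eucl n → ℝ) : Prop :=
  ∀ ψ : Eucl n → ℝ, ContDiffOn ℝ 2 ψ Ω → ∀ x₀ ∈ Ω,
    IsLocalMinOn (fun x => v x - ψ x) Ω x₀ →
    0 ≤ F x₀ (v x₀) (gradient ψ x₀) (hess ψ x₀)

/-- Strict classical (twice differentiable) subsolution on an open set. -/
def StrictClassicalSubsolution (F : Eucl n → ℝ → Eucl n → Mat n → ℝ) (Ω : Set (Eucl n))
    (u : Eucl n → ℝ) : Prop :=
  ContDiffOn ℝ 2 u Ω ∧ ∀ x ∈ Ω, F x (u x) (gradient u x) (hess u x) < 0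

/-- Strict classical (twice differentiable) supersolution on an open set. -/
def StrictClassicalSupersolution (F : Eucl n → ℝ → Eucl n → Mat n → ℝ) (Ω : Set (Eucl n))
    (v : Eucl n → ℝ) : Prop :=
  ContDiffOn ℝ 2 v Ω ∧ ∀ x ∈ Ω, 0 < F x (v x) (gradient v x) (hess v x)

/-- The interior ball condition at a boundary point `w` with radius `ri`. -/
def InteriorBallAt (Ω : Set (Eucl n)) (w : Eucl n) (ri : ℝ) : Prop :=
  ∃ y, ball y ri ⊆ Ω ∧ sphere y ri ∩ frontier Ω = {w}

/-- The interior ball condition (for all boundary points). -/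
def InteriorBallCondition (Ω : Set (Eucl n)) (ri : ℝ) : Prop :=
  ∀ w ∈ frontier Ω, InteriorBallAt Ω w ri

/-- The exterior ball condition at a boundary point `w` with radius `re`. -/
def ExteriorBallAt (Ω : Set (Eucl n)) (w : Eucl n) (re : ℝ) : Prop :=
  ∃ y, ball y re ⊆ Ωᶜ ∧ sphere y re ∩ frontier Ω = {w}

/-- The exterior ball condition (for all boundary points). -/
def ExteriorBallCondition (Ω : Set (Eucl n)) (re : ℝ) : Prop :=
  ∀ w ∈ frontier Ω, ExteriorBallAt Ω w re

/-- The ball condition: both the interior and the exterior ball condition. -/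
def BallCondition (Ω : Set (Eucl n)) (rb : ℝ) : Prop :=
  InteriorBallCondition Ω rb ∧ ExteriorBallCondition Ω rb

/-- The annulus `B(y,R) ∖ closure B(y,r)`. -/
def annulus (y : Eucl n) (r R : ℝ) : Set (Eucl n) := ball y R \ closedBall y r

/-- Under the Osgood condition, the autonomous equation `f' = φ(f)` (with `φ` frozen above `1`)
has a global positive solution which tends to `0` at `-∞`. -/
theorem exists_osgood_flow {φ : ℝ → ℝ} (hφ : PhiAdmissible φ) (hOsg : OsgoodCondition φ) :
    ∃ f : ℝ → ℝ, (∀ t, 0 < f t) ∧ (∀ t, HasDerivAt f (φ (min (f t) 1)) t) ∧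
      Tendsto f atBot (𝓝 0) := by
  obtain ⟨hcont, -, hge⟩ := hφ
  set w : ℝ → ℝ := fun t => 1 / φ (min t 1) with hw
  have hφpos : ∀ t, 0 < t → 0 < φ (min t 1) := fun t ht =>
    (lt_min ht one_pos).trans_le (hge _ (lt_min ht one_pos).le)
  have hwc : ContinuousOn w (Ioi 0) := by
    refine continuousOn_const.div (hcont.comp (by fun_prop) fun t ht => ?_)
      fun t ht => (hφpos t ht).ne'
    exact (lt_min (mem_Ioi.1 ht) one_pos).le
  set G : ℝ → ℝ := fun τ => ∫ t in (1 : ℝ)..Real.exp τ, w t with hG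
  have hGd : ∀ τ, HasDerivAt G (w (Real.exp τ) * Real.exp τ) τ := by
    intro τ
    have hint : IntervalIntegrable w volume 1 (Real.exp τ) := by
      refine (hwc.mono fun t ht => ?_).intervalIntegrable
      exact lt_of_lt_of_le (lt_min one_pos (Real.exp_pos τ)) ht.1
    have h := intervalIntegral.integral_hasDerivAt_right hint
      (hwc.stronglyMeasurableAtFilter isOpen_Ioi _ (Real.exp_pos τ))
      (hwc.continuousAt (Ioi_mem_nhds (Real.exp_pos τ)))
    exact h.comp τ (Real.hasDerivAt_exp τ)
  have hGpos : ∀ τ, 0 < w (Real.exp τ) * Real.exp τ := fun τ =>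
    mul_pos (one_div_pos.2 (hφpos _ (Real.exp_pos τ))) (Real.exp_pos τ)
  have hGmono : StrictMono G := strictMono_of_deriv_pos fun τ => by
    rw [(hGd τ).deriv]; exact hGpos τ
  have hGcont : Continuous G := continuous_iff_continuousAt.2 fun τ => (hGd τ).continuousAt
  have hGtop : Tendsto G atTop atTop := by
    have h1 : Tendsto (fun τ => (Real.exp τ - 1) * (1 / φ 1)) atTop atTop :=
      (tendsto_atTop_add_const_right _ (-1) Real.tendsto_exp_atTop).atTop_mul_const
        (one_div_pos.2 (by simpa using hφpos 1 one_pos))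
    refine h1.congr' ?_
    filter_upwards [eventually_ge_atTop 0] with τ hτ
    have h2 : G τ = ∫ t in (1 : ℝ)..Real.exp τ, 1 / φ 1 := by
      refine intervalIntegral.integral_congr fun t ht => ?_
      rw [uIcc_of_le (Real.one_le_exp hτ)] at ht
      simp only [hw, min_eq_right ht.1]
    rw [h2, intervalIntegral.integral_const, smul_eq_mul]
  have hGbot : Tendsto G atBot atBot := by
    have h1 : Tendsto Real.exp atBot (𝓝[>] 0) := Real.tendsto_exp_atBot_nhdsGT
    refine (tendsto_neg_atTop_atBot.comp (hOsg.comp h1)).congr' ?_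
    filter_upwards [eventually_le_atBot 0] with τ hτ
    simp only [Function.comp_apply, hG]
    rw [intervalIntegral.integral_symm, neg_neg]
    refine intervalIntegral.integral_congr fun t ht => ?_
    rw [uIcc_of_ge (Real.exp_le_one_iff.2 hτ)] at ht
    simp only [hw, min_eq_left ht.2]
  let e := hGmono.orderIsoOfSurjective G (hGcont.surjective hGtop hGbot)
  have hGe : ∀ y, G (e.symm y) = y := fun y => e.apply_symm_apply y
  refine ⟨fun y => Real.exp (e.symm y), fun _ => Real.exp_pos _, fun y => ?_, ?_⟩
  · have h := (HasDerivAt.of_local_left_inverse e.symm.continuous.continuousAt (hGd (e.symm y))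
      (hGpos _).ne' (Eventually.of_forall hGe)).exp
    convert h using 1
    have := Real.exp_pos (e.symm y)
    have := hφpos _ this
    simp only [hw]
    field_simp
  · exact Real.tendsto_exp_atBot.comp e.symm.tendsto_atBot

/-- A one-dimensional barrier profile: `V' = g` and `g' = K φ(g)`, arbitrarily small up to `S`. -/
theorem exists_barrier_profile {φ : ℝ → ℝ} (hφ : PhiAdmissible φ) (hOsg : OsgoodCondition φ)
    {K S ε : ℝ} (hK : 0 < K) (hS : 0 < S) (hε : 0 < ε) :
    ∃ V g : ℝ → ℝ, ContDiff ℝ 2 V ∧ StrictMono V ∧ V 0 = 0 ∧ V S < ε ∧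
      (∀ s, HasDerivAt V (g s) s) ∧ (∀ s, 0 < g s) ∧ (∀ s ≤ S, g s ≤ 1) ∧
      ∀ s, HasDerivAt g (K * φ (min (g s) 1)) s := by
  obtain ⟨f, hfpos, hfd, hf0⟩ := exists_osgood_flow hφ hOsg
  obtain ⟨hcont, -, hge⟩ := hφ
  have hlim : Tendsto (fun a => f (K * S + a)) atBot (𝓝 0) :=
    hf0.comp (tendsto_atBot_add_const_left _ _ tendsto_id)
  obtain ⟨a, ha1, haε⟩ := ((hlim.eventually (gt_mem_nhds one_pos)).and
    (hlim.eventually (gt_mem_nhds (div_pos hε hS)))).exists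
  set g : ℝ → ℝ := fun s => f (K * s + a) with hg
  have hgpos : ∀ s, 0 < g s := fun s => hfpos _
  have hgd : ∀ s, HasDerivAt g (K * φ (min (g s) 1)) s := by
    intro s
    have h1 : HasDerivAt (fun s => K * s + a) K s := by
      simpa using ((hasDerivAt_id s).const_mul K).add_const a
    rw [mul_comm]
    exact (hfd (K * s + a)).comp s h1
  have hgc : Continuous g := continuous_iff_continuousAt.2 fun s => (hgd s).continuousAt
  have hgm : StrictMono g := strictMono_of_deriv_pos fun s => by
    rw [(hgd s).deriv]
    have := lt_min (hgpos s) one_pos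
    exact mul_pos hK (this.trans_le (hge _ this.le))
  set V : ℝ → ℝ := fun s => ∫ t in (0 : ℝ)..s, g t with hV
  have hVd : ∀ s, HasDerivAt V (g s) s := fun s => hgc.integral_hasStrictDerivAt 0 s |>.hasDerivAt
  have hg1 : ContDiff ℝ 1 g := by
    refine contDiff_one_iff_deriv.2 ⟨fun s => (hgd s).differentiableAt, ?_⟩
    rw [funext fun s => (hgd s).deriv]
    exact continuous_const.mul (hcont.comp_continuous (by fun_prop)
      fun s => (lt_min (hgpos s) one_pos).le)
  refine ⟨V, g, ?_, strictMono_of_deriv_pos fun s => by rw [(hVd s).deriv]; exact hgpos s,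
    intervalIntegral.integral_same, ?_, hVd, hgpos, fun s hs => (hgm.monotone hs).trans ha1.le,
    hgd⟩
  · refine (contDiff_succ_iff_deriv (n := 1)).2
      ⟨fun s => (hVd s).differentiableAt, by simp, ?_⟩
    rwa [funext fun s => (hVd s).deriv]
  · have h : V S ≤ ∫ _ in (0 : ℝ)..S, g S :=
      intervalIntegral.integral_mono_on hS.le (hgc.intervalIntegrable _ _)
        (by simp) fun t ht => hgm.monotone ht.2
    rw [intervalIntegral.integral_const, smul_eq_mul, sub_zero] at h
    exact h.trans_lt ((lt_div_iff₀' hS).1 haε)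

/-- A lower bound for the Pucci minimal operator in terms of an upper bound of the quadratic form
and the trace. -/
theorem le_pucciMinus {n : ℕ} {lam Lam a : ℝ} (hlamLam : lam ≤ Lam) (ha : 0 ≤ a)
    {X : Mat n} (hX : X.IsHermitian) (hXa : ∀ v : Fin n → ℝ, v ⬝ᵥ X.mulVec v ≤ a * (v ⬝ᵥ v)) :
    -(lam * X.trace) - (Lam - lam) * (n * a) ≤ pucciMinus lam Lam X := by
  have hle : ∀ i, hX.eigenvalues i ≤ a := by
    intro i
    have h := hXa (hX.eigenvectorBasis i).ofLp
    rw [hX.mulVec_eigenvectorBasis, dotProduct_smul, smul_eq_mul] at h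
    have h1 : (hX.eigenvectorBasis i).ofLp ⬝ᵥ (hX.eigenvectorBasis i).ofLp = 1 := by
      have h2 := EuclideanSpace.real_norm_sq_eq (hX.eigenvectorBasis i)
      rw [hX.eigenvectorBasis.norm_eq_one] at h2
      simp only [dotProduct, ← sq]
      linarith
    rw [h1] at h
    linarith
  have htr : X.trace = ∑ i, hX.eigenvalues i := by
    simpa using hX.trace_eq_sum_eigenvalues
  have hna : (n : ℝ) * a = ∑ _i : Fin n, a := by simp
  simp only [pucciMinus, eigenvals, dif_pos hX]
  rw [htr, hna, Finset.mul_sum, Finset.mul_sum, ← Finset.sum_neg_distrib, ← Finset.sum_sub_distrib]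
  refine Finset.sum_le_sum fun i _ => ?_
  have := hle i
  have := sub_nonneg.2 hlamLam
  split_ifs with h <;> nlinarith

theorem hasFDerivAt_sub_norm_sub_sq (y : Eucl n) (m : ℝ) (x : Eucl n) :
    HasFDerivAt (fun x => m - ‖x - y‖ ^ 2) (-(2 : ℝ) • innerSL ℝ (x - y)) x := by
  refine ((((hasFDerivAt_id x).sub_const y).norm_sq).const_sub m).congr_fderiv ?_
  ext v
  simp

theorem hasFDerivAt_radial {V g : ℝ → ℝ} (hV : ∀ s, HasDerivAt V (g s) s) (c m : ℝ)
    (y x : Eucl n) :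
    HasFDerivAt (fun x => c - V (m - ‖x - y‖ ^ 2))
      ((2 * g (m - ‖x - y‖ ^ 2)) • innerSL ℝ (x - y)) x := by
  refine (((hV (m - ‖x - y‖ ^ 2)).comp_hasFDerivAt x
    (hasFDerivAt_sub_norm_sub_sq y m x)).const_sub c).congr_fderiv ?_
  ext v
  simp
  ring

theorem gradient_radial {V g : ℝ → ℝ} (hV : ∀ s, HasDerivAt V (g s) s) (c m : ℝ)
    (y x : Eucl n) :
    gradient (fun x => c - V (m - ‖x - y‖ ^ 2)) x = (2 * g (m - ‖x - y‖ ^ 2)) • (x - y) := by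
  apply HasGradientAt.gradient
  rw [hasGradientAt_iff_hasFDerivAt]
  refine (hasFDerivAt_radial hV c m y x).congr_fderiv ?_
  ext v
  simp

theorem hess_radial {V g k : ℝ → ℝ} (hV : ∀ s, HasDerivAt V (g s) s)
    (hg : ∀ s, HasDerivAt g (k s) s) (c m : ℝ) (y x : Eucl n) :
    hess (fun x => c - V (m - ‖x - y‖ ^ 2)) x =
      (2 * g (m - ‖x - y‖ ^ 2)) • (1 : Mat n) -
        (4 * k (m - ‖x - y‖ ^ 2)) • Matrix.vecMulVec (x - y).ofLp (x - y).ofLp := by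
  have h2 : HasFDerivAt (fun x => (2 * g (m - ‖x - y‖ ^ 2)) • innerSL ℝ (x - y)) _ x :=
    (((hg (m - ‖x - y‖ ^ 2)).comp_hasFDerivAt x
      (hasFDerivAt_sub_norm_sub_sq y m x)).const_mul 2).smul
      ((innerSL ℝ).hasFDerivAt.comp x ((hasFDerivAt_id x).sub_const y))
  ext i j
  rw [hess, Matrix.of_apply, iteratedFDeriv_two_apply,
    funext fun x => (hasFDerivAt_radial hV c m y x).fderiv, h2.fderiv]
  have hs : (innerSL ℝ (EuclideanSpace.single i (1 : ℝ))) (EuclideanSpace.single j (1 : ℝ)) =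
      if i = j then 1 else 0 := by
    rw [innerSL_apply_apply, EuclideanSpace.inner_single_left]
    simp
  simp [Matrix.one_apply, Matrix.vecMulVec_apply, EuclideanSpace.inner_single_right, hs]
  ring

/-- The radial barrier is a strict supersolution wherever the ellipticity constant `K` in the
profile dominates. -/
theorem radial_barrier_strict {lam Lam K c m : ℝ} (hlam : 0 < lam) (hlamLam : lam ≤ Lam)
    (hK : 0 < K) {φ : ℝ → ℝ} (hφ : PhiAdmissible φ) {V g : ℝ → ℝ}
    (hV : ∀ s, HasDerivAt V (g s) s) (hgpos : ∀ s, 0 < g s)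
    (hg : ∀ s, HasDerivAt g (K * φ (min (g s) 1)) s) {x y : Eucl n}
    (hg1 : g (m - ‖x - y‖ ^ 2) ≤ 1) (hxy : ‖x - y‖ ≤ 1 / 2)
    (hKxy : 1 + 2 * Lam * n < 4 * lam * K * ‖x - y‖ ^ 2) :
    φ ‖gradient (fun x => c - V (m - ‖x - y‖ ^ 2)) x‖ <
      pucciMinus lam Lam (hess (fun x => c - V (m - ‖x - y‖ ^ 2)) x) := by
  obtain ⟨-, hmono, hge⟩ := hφ
  rw [gradient_radial hV, hess_radial hV hg, min_eq_left hg1]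
  set p := g (m - ‖x - y‖ ^ 2)
  have hp : 0 < p := hgpos _
  have hpφ : p ≤ φ p := hge p hp.le
  have hgrad : φ ‖(2 * p) • (x - y)‖ ≤ φ p := by
    refine hmono.monotoneOn (norm_nonneg _) hp.le ?_
    rw [norm_smul, Real.norm_of_nonneg (by positivity)]
    nlinarith
  have hv : (x - y).ofLp ⬝ᵥ (x - y).ofLp = ‖x - y‖ ^ 2 := by
    rw [EuclideanSpace.real_norm_sq_eq]
    simp only [dotProduct, sq]
  have hherm : ((2 * p) • (1 : Mat n) -
      (4 * (K * φ p)) • Matrix.vecMulVec (x - y).ofLp (x - y).ofLp).IsHermitian := by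
    ext i j
    simp only [Matrix.conjTranspose_apply, Matrix.sub_apply, Matrix.smul_apply, Matrix.one_apply,
      Matrix.vecMulVec_apply, star_trivial, eq_comm (a := j), mul_comm ((x - y).ofLp j)]
  have hquad : ∀ v : Fin n → ℝ, v ⬝ᵥ ((2 * p) • (1 : Mat n) -
      (4 * (K * φ p)) • Matrix.vecMulVec (x - y).ofLp (x - y).ofLp).mulVec v ≤
        2 * p * (v ⬝ᵥ v) := by
    intro v
    rw [Matrix.sub_mulVec, Matrix.smul_mulVec, Matrix.smul_mulVec, Matrix.one_mulVec,
      Matrix.vecMulVec_mulVec, dotProduct_sub, dotProduct_smul, dotProduct_smul, dotProduct_smul]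
    simp only [op_smul_eq_smul, smul_eq_mul, dotProduct_comm v (x - y).ofLp]
    have : 0 ≤ 4 * (K * φ p) := by nlinarith [mul_pos hK (hp.trans_le hpφ)]
    nlinarith [mul_nonneg this (mul_self_nonneg ((x - y).ofLp ⬝ᵥ v))]
  refine hgrad.trans_lt (lt_of_lt_of_le ?_ (le_pucciMinus hlamLam (by positivity) hherm hquad))
  rw [Matrix.trace_sub, Matrix.trace_smul, Matrix.trace_smul, Matrix.trace_one,
    Matrix.trace_vecMulVec, hv, Fintype.card_fin, smul_eq_mul, smul_eq_mul]
  have h1 := mul_lt_mul_of_pos_right hKxy (hp.trans_le hpφ)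
  have h2 : 0 ≤ 2 * Lam * n := by
    have := hlam.le.trans hlamLam
    positivity
  nlinarith [mul_le_mul_of_nonneg_left hpφ h2]

/-- Hopf-type lemma: the set where a subsolution attains its positive maximum cannot be touched
at `w` by a small ball on which the subsolution is strictly below its maximum. -/
theorem lt_of_touching_ball {lam Lam : ℝ} (hlam : 0 < lam) (hlamLam : lam ≤ Lam)
    {φ : ℝ → ℝ} (hφ : PhiAdmissible φ) (hOsg : OsgoodCondition φ)
    {F : Eucl n → ℝ → Eucl n → Mat n → ℝ} (hF1 : CondF1 F) (hF2A : CondF2A lam Lam φ F)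
    {Ω : Set (Eucl n)} {u : Eucl n → ℝ} (husc : UpperSemicontinuousOn u Ω)
    (hsub : ViscositySubsolution F Ω u) {M : ℝ} (hM : 0 < M) (hmax : ∀ x ∈ Ω, u x ≤ M)
    {y w : Eucl n} {R : ℝ} (hR : 0 < R) (hR4 : R ≤ 1 / 4) (hw : ‖w - y‖ = R)
    (hwΩ : closedBall w (R / 2) ⊆ Ω) (hlt : ∀ x ∈ Ω, ‖x - y‖ ≤ R → x ≠ w → u x < M) :
    u w < M := by
  by_contra! huw
  have hLam : 0 < Lam := hlam.trans_le hlamLam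
  obtain ⟨η, hη, hηT⟩ : ∃ η > 0, ∀ x ∈ sphere w (R / 2), ‖x - y‖ ≤ R → u x ≤ M - η := by
    have hT : IsCompact (sphere w (R / 2) ∩ closedBall y R) :=
      (isCompact_sphere _ _).inter_right isClosed_closedBall
    have hTΩ : sphere w (R / 2) ∩ closedBall y R ⊆ Ω := fun x hx =>
      hwΩ (sphere_subset_closedBall hx.1)
    rcases (sphere w (R / 2) ∩ closedBall y R).eq_empty_or_nonempty with he | hne
    · refine ⟨1, one_pos, fun x hx hxy => absurd ?_ (he ▸ notMem_empty x)⟩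
      exact ⟨hx, mem_closedBall_iff_norm.2 hxy⟩
    · obtain ⟨a, ha, hamax⟩ := (husc.mono hTΩ).exists_isMaxOn hne hT
      have haw : a ≠ w := by
        rintro rfl
        have := ha.1
        simp at this
        linarith
      refine ⟨M - u a, sub_pos.2 (hlt a (hTΩ ha) (mem_closedBall_iff_norm.1 ha.2) haw),
        fun x hx hxy => ?_⟩
      have : u x ≤ u a := hamax ⟨hx, mem_closedBall_iff_norm.2 hxy⟩
      linarith
  set K := (2 + 2 * Lam * n) / (lam * R ^ 2) with hKdef
  have hK : 0 < K := by positivity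
  have hKR : lam * R ^ 2 * K = 2 + 2 * Lam * n := by
    rw [hKdef]
    field_simp
  obtain ⟨V, g, hVC, hVm, hV0, hVS, hVd, hgpos, hg1, hgd⟩ :=
    exists_barrier_profile hφ hOsg hK (pow_pos hR 2) (lt_min hη hM)
  set ψ : Eucl n → ℝ := fun x => M - V (R ^ 2 - ‖x - y‖ ^ 2) with hψ
  have hψC : ContDiff ℝ 2 ψ := by
    have : ContDiff ℝ 2 fun x : Eucl n => R ^ 2 - ‖x - y‖ ^ 2 :=
      contDiff_const.sub ((contDiff_id.sub contDiff_const).norm_sq ℝ)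
    exact contDiff_const.sub (hVC.comp this)
  have hVle : ∀ x, V (R ^ 2 - ‖x - y‖ ^ 2) ≤ V (R ^ 2) := fun x =>
    hVm.monotone (by linarith [sq_nonneg ‖x - y‖])
  have husc' : UpperSemicontinuousOn (fun x => u x - ψ x) (closedBall w (R / 2)) := by
    have h := (husc.mono hwΩ).add
      (hψC.continuous.neg.upperSemicontinuous.upperSemicontinuousOn (closedBall w (R / 2)))
    simp only [sub_eq_add_neg]
    exact h
  obtain ⟨x₁, hx₁, hx₁max⟩ := husc'.exists_isMaxOn ⟨w, mem_closedBall_self (by positivity)⟩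
    (isCompact_closedBall _ _)
  have hx₁Ω := hwΩ hx₁
  have hx₁nonneg : ψ x₁ ≤ u x₁ := by
    have h : u w - ψ w ≤ u x₁ - ψ x₁ := hx₁max (mem_closedBall_self (by positivity))
    have hψw : ψ w = M := by simp [hψ, hw, hV0]
    linarith
  have hx₁ball : x₁ ∈ ball w (R / 2) := by
    by_contra hnb
    have hs : x₁ ∈ sphere w (R / 2) :=
      le_antisymm (mem_closedBall.1 hx₁) (not_lt.1 fun h => hnb (mem_ball.2 h))
    rcases le_or_gt ‖x₁ - y‖ R with hle | hgt
    · have := hηT x₁ hs hle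
      have := hVle x₁
      have := hVS.trans_le (min_le_left _ _)
      simp only [hψ] at hx₁nonneg
      linarith
    · have h : V (R ^ 2 - ‖x₁ - y‖ ^ 2) < V 0 := hVm (by nlinarith)
      have := hmax x₁ hx₁Ω
      simp only [hψ] at hx₁nonneg
      linarith
  have hlocal : IsLocalMaxOn (fun x => u x - ψ x) Ω x₁ :=
    (hx₁max.isLocalMax (Filter.mem_of_superset (isOpen_ball.mem_nhds hx₁ball)
      ball_subset_closedBall)).on Ω
  have hvisc := hsub ψ hψC.contDiffOn x₁ hx₁Ω hlocal
  have hupos : 0 ≤ u x₁ := by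
    have := hVle x₁
    have := hVS.trans_le (min_le_right _ _)
    simp only [hψ] at hx₁nonneg
    linarith
  have hdist : ‖x₁ - w‖ ≤ R / 2 := mem_closedBall_iff_norm.1 hx₁
  have hupper : ‖x₁ - y‖ ≤ 1 / 2 := by
    have := norm_sub_le_norm_sub_add_norm_sub x₁ w y
    linarith
  have hlower : R / 2 ≤ ‖x₁ - y‖ := by
    have := norm_sub_le_norm_sub_add_norm_sub w x₁ y
    rw [norm_sub_rev w x₁] at this
    linarith
  have hKx : 1 + 2 * Lam * n < 4 * lam * K * ‖x₁ - y‖ ^ 2 := by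
    have : (R / 2) ^ 2 ≤ ‖x₁ - y‖ ^ 2 := by gcongr
    have := mul_le_mul_of_nonneg_left this (by positivity : 0 ≤ 4 * lam * K)
    nlinarith
  have hstrict := radial_barrier_strict (c := M) (m := R ^ 2) hlam hlamLam hK hφ hVd hgpos hgd
    (hg1 _ (by linarith [sq_nonneg ‖x₁ - y‖])) hupper hKx
  have hherm : (hess ψ x₁).IsHermitian := by
    have := (hψC.contDiffAt (x := x₁)).isSymmSndFDerivAt (by simp)
    ext i j
    simp only [hess, Matrix.conjTranspose_apply, Matrix.of_apply, star_trivial,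
      iteratedFDeriv_two_apply]
    exact this _ _
  have h1 := hF1 x₁ (u x₁) 0 (gradient ψ x₁) (hess ψ x₁) (hess ψ x₁) hupos
    (by simpa [matLE] using Matrix.PosSemidef.zero)
  have h2 := hF2A x₁ (gradient ψ x₁) (hess ψ x₁) hherm
  linarith

/-- If a relatively closed set `A` in an open set has a non-interior point, there is an arbitrarily
small ball inside the complement of `A` which touches `A` at exactly one point. -/
theorem exists_touching_ball {A Ω : Set (Eucl n)} (hΩo : IsOpen Ω) (hAΩ : A ⊆ Ω)
    (hA : ∀ C ⊆ Ω, IsCompact C → IsCompact (C ∩ A)) {p : Eucl n} (hp : p ∈ A)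
    (hpA : p ∉ interior A) :
    ∃ (y w : Eucl n) (R : ℝ), 0 < R ∧ R ≤ 1 / 4 ∧ w ∈ A ∧ ‖w - y‖ = R ∧
      closedBall w (R / 2) ⊆ Ω ∧ ∀ x, ‖x - y‖ ≤ R → x ≠ w → x ∉ A := by
  obtain ⟨δ₀, hδ₀, hball⟩ := Metric.isOpen_iff.1 hΩo p (hAΩ hp)
  set δ := min (δ₀ / 4) (1 / 4) with hδdef
  have hδ : 0 < δ := by positivity
  have hδ1 : δ ≤ δ₀ / 4 := min_le_left _ _
  have hδ2 : δ ≤ 1 / 4 := min_le_right _ _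
  obtain ⟨z, hzp, hzA⟩ : ∃ z ∈ ball p δ, z ∉ A := by
    by_contra! h
    exact hpA (mem_interior.2 ⟨ball p δ, h, isOpen_ball, mem_ball_self hδ⟩)
  rw [mem_ball] at hzp
  have hC : IsCompact (closedBall p (2 * δ) ∩ A) :=
    hA _ (fun x hx => hball (by rw [mem_closedBall] at hx; rw [mem_ball]; linarith))
      (isCompact_closedBall _ _)
  obtain ⟨w, ⟨hwp, hwA⟩, hwmin⟩ := hC.exists_isMinOn ⟨p, mem_closedBall_self (by positivity), hp⟩
    (f := fun x => dist x z) (by fun_prop)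
  have hwz : dist w z < δ := by
    have : dist w z ≤ dist p z := hwmin ⟨mem_closedBall_self (by positivity), hp⟩
    rw [dist_comm p z] at this
    linarith
  have hwzpos : 0 < dist w z := dist_pos.2 fun h => hzA (h ▸ hwA)
  have hfree : ∀ x, dist x z < dist w z → x ∉ A := by
    intro x hx hxA
    have hxp : dist x p ≤ 2 * δ := by linarith [dist_triangle x z p]
    exact absurd (hwmin ⟨mem_closedBall.2 hxp, hxA⟩ : dist w z ≤ dist x z) (not_le.2 hx)
  have hmid : dist w (midpoint ℝ w z) = dist w z / 2 := by
    rw [dist_left_midpoint]; norm_num; ring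
  have hmid' : dist (midpoint ℝ w z) z = dist w z / 2 := by
    rw [dist_midpoint_right]; norm_num; ring
  refine ⟨midpoint ℝ w z, w, dist w z / 2, by positivity, by linarith, hwA,
    by rw [← dist_eq_norm, hmid], fun x hx => hball ?_, fun x hx hxw => hfree x ?_⟩
  · rw [mem_closedBall] at hx hwp
    rw [mem_ball]
    linarith [dist_triangle x w p]
  · rw [← dist_eq_norm] at hx
    by_contra! hle
    have h1 := dist_triangle x (midpoint ℝ w z) z
    have hxz : dist x z = dist w z := by linarith
    have h2 : midpoint ℝ w z = midpoint ℝ x z :=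
      eq_midpoint_of_dist_eq_half (by linarith) (by linarith)
    rw [midpoint_eq_midpoint_iff_vsub_eq_vsub, vsub_self, vsub_eq_zero_iff_eq] at h2
    exact hxw h2.symm

/-- Theorem 4.1: the Strong Maximum Principle. -/
theorem strong_maximum_principle
    {n : ℕ} (lam Lam : ℝ) (hlam : 0 < lam) (hlamLam : lam ≤ Lam)
    (φ : ℝ → ℝ) (hφ : PhiAdmissible φ) (hOsg : OsgoodCondition φ)
    (F : Eucl n → ℝ → Eucl n → Mat n → ℝ) (hF1 : CondF1 F) (hF2A : CondF2A lam Lam φ F)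
    (Ω : Set (Eucl n)) (hΩo : IsOpen Ω) (hΩc : IsConnected Ω)
    (u : Eucl n → ℝ) (husc : UpperSemicontinuousOn u Ω)
    (hsub : ViscositySubsolution F Ω u)
    (x₀ : Eucl n) (hx₀ : x₀ ∈ Ω) (hpos : 0 < u x₀) (hmax : ∀ x ∈ Ω, u x ≤ u x₀) :
    ∀ x ∈ Ω, u x = u x₀ := by


  set A := Ω ∩ {x | u x₀ ≤ u x} with hAdef
  have hA : ∀ C ⊆ Ω, IsCompact C → IsCompact (C ∩ A) := by
    intro C hCΩ hC
    have h := (husc.mono hCΩ).isCompact_inter_preimage_Ici hC (u x₀)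
    rwa [hAdef, ← inter_assoc, inter_eq_left.2 hCΩ]
  have hAopen : IsOpen A := by
    by_contra hno
    obtain ⟨p, hp, hpA⟩ := not_subset.1 (mt subset_interior_iff_isOpen.1 hno)
    obtain ⟨y, w, R, hR, hR4, hwA, hwy, hwΩ, hfree⟩ :=
      exists_touching_ball hΩo inter_subset_left hA hp hpA
    exact (lt_of_touching_ball hlam hlamLam hφ hOsg hF1 hF2A husc hsub hpos hmax hR hR4 hwy
      hwΩ fun x hx hxy hxw => not_le.1 fun h => hfree x hxy hxw ⟨hx, h⟩).not_ge hwA.2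
  obtain ⟨U, hUo, hU⟩ := upperSemicontinuousOn_iff_preimage_Iio.1 husc (u x₀)
  have hsubA : Ω ⊆ A := by
    refine hΩc.isPreconnected.subset_left_of_subset_union hAopen (hΩo.inter hUo) ?_ ?_
      ⟨x₀, hx₀, hx₀, le_refl (u x₀)⟩
    · rw [← hU]
      exact disjoint_left.2 fun x hx hx' => not_le.2 (show u x < u x₀ from hx'.2) hx.2
    · rw [← hU]
      exact fun x hx => (le_or_gt (u x₀) (u x)).imp (⟨hx, ·⟩) (⟨hx, ·⟩)
  exact fun x hx => (hmax x hx).antisymm (hsubA hx).2
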